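/- Let A be a Banach algebra and let I be a two-sided ideal of A that is maximal among the left ideals of A that are not finitely generated. Then either I = A, or I is a maximal modular two-sided ideal of codimension 1 in A. -/

import Mathlib

noncomputable section

/-- A left ideal of an algebra `A`, encoded as a `ℂ`-submodule closed under
left multiplication by arbitrary elements of `A`. -/
def IsLeftIdeal {A : Type*} [NonUnitalNonAssocSemiring A] [Module ℂ A]
    (I : Submodule ℂ A) : Prop :=
  ∀ a : A, ∀ x ∈ I, a * x ∈ I

/-- The left ideal generated by a set `S` (equivalently `⟨S⟩ = A♯·S`). -/
def leftIdealGen {A : Type*} [NonUnitalNonAssocSemiring A] [Module ℂ A]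
    (S : Set A) : Submodule ℂ A :=
  sInf {I : Submodule ℂ A | IsLeftIdeal I ∧ S ⊆ ↑I}

/-- A left ideal is finitely generated if it is generated by a finite subset of itself. -/
def IsFGLeftIdeal {A : Type*} [NonUnitalNonAssocSemiring A] [Module ℂ A]
    (I : Submodule ℂ A) : Prop :=
  ∃ S : Finset A, ↑S ⊆ (I : Set A) ∧ leftIdealGen (↑S : Set A) = I

/-- A left ideal is countably generated if it is generated by a countable subset of itself. -/
def IsCGLeftIdeal {A : Type*} [NonUnitalNonAssocSemiring A] [Module ℂ A]
    (I : Submodule ℂ A) : Prop :=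
  ∃ S : Set A, S.Countable ∧ S ⊆ (I : Set A) ∧ leftIdealGen S = I

/-- Membership in `𝔐∞(A)`: a maximal element of the family of
non-finitely-generated left ideals. -/
def IsMaxNonFG {A : Type*} [NonUnitalNonAssocSemiring A] [Module ℂ A]
    (M : Submodule ℂ A) : Prop :=
  IsLeftIdeal M ∧ ¬ IsFGLeftIdeal M ∧
    ∀ J : Submodule ℂ A, IsLeftIdeal J → ¬ IsFGLeftIdeal J → M ≤ J → J = M

/-- Membership in `𝔑∞(A)`: a maximal element of the family of
non-countably-generated left ideals. -/
def IsMaxNonCG {A : Type*} [NonUnitalNonAssocSemiring A] [Module ℂ A]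
    (M : Submodule ℂ A) : Prop :=
  IsLeftIdeal M ∧ ¬ IsCGLeftIdeal M ∧
    ∀ J : Submodule ℂ A, IsLeftIdeal J → ¬ IsCGLeftIdeal J → M ≤ J → J = M

/-- `M` is a maximal left ideal. -/
def IsMaxLeftIdeal {A : Type*} [NonUnitalNonAssocSemiring A] [Module ℂ A]
    (M : Submodule ℂ A) : Prop :=
  IsLeftIdeal M ∧ M ≠ ⊤ ∧ ∀ J : Submodule ℂ A, IsLeftIdeal J → M < J → J = ⊤

section helpers

open Topology Filter

/-- If all translates of `T` have closed range, `T` has an eigenvector. -/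
lemma exists_eigen_of_closed_range {E : Type*} [NormedAddCommGroup E] [NormedSpace ℂ E]
    [CompleteSpace E] [Nontrivial E] (T : E →L[ℂ] E)
    (hT : ∀ z : ℂ, IsClosed (Set.range (fun x : E => z • x - T x))) :
    ∃ z : ℂ, ∃ x : E, x ≠ 0 ∧ T x = z • x := by
  by_contra hcon
  push Not at hcon
  have hne : (spectrum ℂ T).Nonempty := spectrum.nonempty T
  have hnu : spectrum ℂ T ≠ Set.univ := by
    intro h
    have hb := spectrum.isBounded (𝕜 := ℂ) T
    rw [h] at hb
    exact NormedSpace.unbounded_univ ℂ ℂ hb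
  obtain ⟨z, hz⟩ := nonempty_frontier_iff.2 ⟨hne, hnu⟩
  have hzs : z ∈ spectrum ℂ T := (spectrum.isClosed T).frontier_subset hz
  have hzc : z ∈ closure (spectrum ℂ T)ᶜ := by
    rw [frontier_eq_closure_inter_closure] at hz
    exact hz.2
  set R : E →L[ℂ] E := algebraMap ℂ (E →L[ℂ] E) z - T with hR
  have happ : ∀ (w : ℂ) (x : E), (algebraMap ℂ (E →L[ℂ] E) w - T) x = w • x - T x := by
    intro w x
    simp [Algebra.algebraMap_eq_smul_one]
  have hRapp : ∀ x : E, R x = z • x - T x := happ z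
  have hinj : Function.Injective R := by
    rw [injective_iff_map_eq_zero]
    intro x hx
    by_contra hx0
    apply hcon z x hx0
    rw [hRapp, sub_eq_zero] at hx
    exact hx.symm
  have hcl : IsClosed (Set.range R) := by
    have : (R : E → E) = fun x => z • x - T x := funext hRapp
    rw [this]
    exact hT z
  obtain ⟨K, hK⟩ := R.antilipschitz_of_injective_of_isClosed_range hinj hcl
  have hbd : ∀ x : E, ‖x‖ ≤ K * ‖R x‖ := fun x => by
    simpa [dist_eq_norm] using hK.le_mul_dist x 0
  apply hzs
  change IsUnit R
  rw [ContinuousLinearMap.isUnit_iff_bijective]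
  refine ⟨hinj, fun y => ?_⟩
  have : y ∈ closure (Set.range R) := by
    rw [Metric.mem_closure_iff]
    intro ε hε
    -- choose w close to z
    set δ : ℝ := min (1 / (2 * (K + 1))) (ε / (2 * K * ‖y‖ + 1)) with hδ
    have hKn : (0 : ℝ) ≤ K := K.2
    have hy0 := norm_nonneg y
    have hδ0 : 0 < δ := by positivity
    obtain ⟨w, hw, hwz⟩ := Metric.mem_closure_iff.1 hzc δ hδ0
    have hwu : IsUnit (algebraMap ℂ (E →L[ℂ] E) w - T) := by
      simpa [spectrum.mem_iff] using hw
    rw [ContinuousLinearMap.isUnit_iff_bijective] at hwu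
    obtain ⟨x, hx⟩ := hwu.2 y
    rw [happ] at hx
    have hwz' : ‖z - w‖ < δ := by rwa [dist_eq_norm] at hwz
    have hRx : R x = y + (z - w) • x := by
      rw [hRapp, ← hx, sub_smul]; abel
    have h1 : ‖R x‖ ≤ ‖y‖ + δ * ‖x‖ := by
      rw [hRx]
      refine (norm_add_le _ _).trans ?_
      rw [norm_smul]
      gcongr
    have h2 := hbd x
    have hx0 := norm_nonneg x
    have h3 : (K : ℝ) * δ ≤ 1 / 2 := by
      calc (K : ℝ) * δ ≤ K * (1 / (2 * (K + 1))) := by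
            gcongr; exact min_le_left _ _
        _ ≤ 1 / 2 := by
            rw [mul_one_div, div_le_div_iff₀ (by positivity) (by norm_num)]
            linarith
    have h4 : ‖x‖ ≤ 2 * K * ‖y‖ := by
      have := mul_le_mul_of_nonneg_left h1 hKn
      have := mul_le_mul_of_nonneg_right h3 hx0
      nlinarith
    refine ⟨R x, ⟨x, rfl⟩, ?_⟩
    rw [dist_eq_norm, hRx, norm_sub_rev, add_sub_cancel_left, norm_smul]
    have h5 : δ * (2 * K * ‖y‖ + 1) ≤ ε := by
      rw [← le_div_iff₀ (by positivity)]
      exact min_le_right _ _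
    have h6 : ‖z - w‖ * ‖x‖ ≤ δ * (2 * K * ‖y‖) := by gcongr
    linarith
  rw [hcl.closure_eq] at this
  exact this

section alg
variable {A : Type*} [NonUnitalNormedRing A] [NormedSpace ℂ A]
    [IsScalarTower ℂ A A] [SMulCommClass ℂ A A]

lemma subset_leftIdealGen (S : Set A) : S ⊆ (leftIdealGen S : Set A) := by
  intro x hx
  simp only [leftIdealGen, SetLike.mem_coe, Submodule.mem_sInf]
  exact fun I hI => hI.2 hx

lemma leftIdealGen_le {S : Set A} {J : Submodule ℂ A} (hJ : IsLeftIdeal J) (h : S ⊆ J) :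
    leftIdealGen S ≤ J := sInf_le ⟨hJ, h⟩

lemma isLeftIdeal_leftIdealGen (S : Set A) : IsLeftIdeal (leftIdealGen S) := by
  intro a x hx
  simp only [leftIdealGen, Submodule.mem_sInf] at hx ⊢
  exact fun I hI => hI.1 a x (hx I hI)

/-- The map `(a, l) ↦ a * x + l • x`. -/
def sharpMul (x : A) : (A × ℂ) →L[ℂ] A :=
  ((ContinuousLinearMap.mul ℂ A).flip x).coprod (ContinuousLinearMap.toSpanSingleton ℂ x)

lemma sharpMul_apply (x : A) (p : A × ℂ) : sharpMul x p = p.1 * x + p.2 • x := by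
  simp [sharpMul]

lemma sharpMul_mem {J : Submodule ℂ A} (hJ : IsLeftIdeal J) {x : A} (hx : x ∈ J) (p : A × ℂ) :
    sharpMul x p ∈ J := by
  rw [sharpMul_apply]
  exact J.add_mem (hJ _ _ hx) (J.smul_mem _ hx)

/-- `p ↦ ∑ p_k x_k`. -/
def sumMul {ι : Type*} [Fintype ι] (x : ι → A) : (ι → A × ℂ) →L[ℂ] A :=
  ∑ i, (sharpMul (x i)).comp (ContinuousLinearMap.proj i)

lemma sumMul_apply {ι : Type*} [Fintype ι] (x : ι → A) (p : ι → A × ℂ) :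
    sumMul x p = ∑ i, ((p i).1 * x i + (p i).2 • x i) := by
  simp [sumMul, sharpMul_apply]

lemma sumMul_mem {ι : Type*} [Fintype ι] {J : Submodule ℂ A} (hJ : IsLeftIdeal J) {x : ι → A}
    (hx : ∀ i, x i ∈ J) (p : ι → A × ℂ) : sumMul x p ∈ J := by
  rw [sumMul_apply]
  exact J.sum_mem fun i _ => J.add_mem (hJ _ _ (hx i)) (J.smul_mem _ (hx i))

lemma isLeftIdeal_range_sumMul {ι : Type*} [Fintype ι] (x : ι → A) :
    IsLeftIdeal (LinearMap.range (sumMul x : (ι → A × ℂ) →ₗ[ℂ] A)) := by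
  rintro a _ ⟨p, rfl⟩
  refine ⟨fun i => (a * (p i).1 + (p i).2 • a, 0), ?_⟩
  simp only [ContinuousLinearMap.coe_coe, sumMul_apply, Finset.mul_sum]
  refine Finset.sum_congr rfl fun i _ => ?_
  simp [mul_add, add_mul, mul_assoc, smul_mul_assoc, mul_smul_comm]

lemma gen_le_range_sumMul (S : Finset A) :
    leftIdealGen (S : Set A) ≤
      LinearMap.range (sumMul (fun i : S => (i : A)) : (S → A × ℂ) →ₗ[ℂ] A) := by
  classical
  refine leftIdealGen_le (isLeftIdeal_range_sumMul _) ?_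
  intro s hs
  refine ⟨Pi.single ⟨s, hs⟩ (0, 1), ?_⟩
  simp only [ContinuousLinearMap.coe_coe, sumMul_apply]
  rw [Finset.sum_eq_single ⟨s, hs⟩]
  · simp
  · intro b _ hb
    simp [Pi.single_eq_of_ne hb]
  · simp

lemma sumMul_sub_bound {ι : Type*} [Fintype ι] (x y : ι → A) (δ : ℝ)
    (h : ∀ i, ‖x i - y i‖ ≤ δ) (p : ι → A × ℂ) :
    ‖sumMul x p - sumMul y p‖ ≤ (Fintype.card ι * (2 * δ)) * ‖p‖ := by
  rw [sumMul_apply, sumMul_apply, ← Finset.sum_sub_distrib]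
  refine (norm_sum_le _ _).trans ?_
  calc _ ≤ ∑ _i : ι, 2 * δ * ‖p‖ := ?_
    _ = _ := by simp; ring
  refine Finset.sum_le_sum fun i _ => ?_
  have e : (p i).1 * x i + (p i).2 • x i - ((p i).1 * y i + (p i).2 • y i)
      = (p i).1 * (x i - y i) + (p i).2 • (x i - y i) := by
    rw [mul_sub, smul_sub]; abel
  rw [e]
  have hp : ‖p i‖ ≤ ‖p‖ := norm_le_pi_norm p i
  have h1 : ‖(p i).1‖ ≤ ‖p‖ := (norm_fst_le _).trans hp
  have h2 : ‖(p i).2‖ ≤ ‖p‖ := (norm_snd_le _).trans hp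
  calc _ ≤ ‖(p i).1 * (x i - y i)‖ + ‖(p i).2 • (x i - y i)‖ := norm_add_le _ _
    _ ≤ ‖(p i).1‖ * ‖x i - y i‖ + ‖(p i).2‖ * ‖x i - y i‖ := by
        gcongr
        · exact norm_mul_le _ _
        · exact (norm_smul _ _).le
    _ ≤ ‖p‖ * δ + ‖p‖ * δ := by
        gcongr
        · exact h i
        · exact h i
    _ = _ := by ring

/-- A left ideal whose closure is finitely generated is closed. -/
lemma isClosed_of_fg_closure [CompleteSpace A] {J : Submodule ℂ A} (hJ : IsLeftIdeal J)
    (hfg : IsFGLeftIdeal J.topologicalClosure) : IsClosed (J : Set A) := by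
  obtain ⟨S, hSK, hS⟩ := hfg
  set K := J.topologicalClosure with hK
  have hKc : IsClosed (K : Set A) := J.isClosed_topologicalClosure
  have hJK : J ≤ K := J.le_topologicalClosure
  have hKl : IsLeftIdeal K := hS ▸ isLeftIdeal_leftIdealGen _
  haveI : CompleteSpace K := hKc.completeSpace_coe
  let T : (S → A × ℂ) →L[ℂ] K :=
    (sumMul (fun i : S => (i : A))).codRestrict K (sumMul_mem hKl fun i => hSK i.2)
  have hT : T.range = ⊤ := by
    rw [eq_top_iff]
    rintro ⟨k, hk⟩ -
    have hk' := hk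
    rw [← hS] at hk'
    obtain ⟨p, hp⟩ := gen_le_range_sumMul S hk'
    exact ⟨p, Subtype.ext hp⟩
  obtain ⟨N, hN⟩ := T.exists_nonlinearRightInverse_of_surjective hT
  -- the perturbation size
  set n : ℝ := ((Fintype.card S : ℕ) : ℝ) with hn
  have hn0 : 0 ≤ n := by positivity
  have hNi : (0 : ℝ) < (N.nnnorm : ℝ)⁻¹ := inv_pos.2 (by exact_mod_cast hN)
  set δ : ℝ := (N.nnnorm : ℝ)⁻¹ / (4 * (n + 1)) with hδ
  have hδ0 : 0 < δ := by positivity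
  have hex : ∀ i : S, ∃ y ∈ J, ‖(i : A) - y‖ ≤ δ := by
    intro i
    have hi : (i : A) ∈ closure (J : Set A) := hSK i.2
    obtain ⟨y, hy, hd⟩ := Metric.mem_closure_iff.1 hi δ hδ0
    exact ⟨y, hy, by rw [← dist_eq_norm]; exact hd.le⟩
  choose y hyJ hyd using hex
  let T' : (S → A × ℂ) →L[ℂ] K :=
    (sumMul y).codRestrict K (sumMul_mem hKl fun i => hJK (hyJ i))
  let c : NNReal := ⟨n * (2 * δ), by positivity⟩
  have hc : c < N.nnnorm⁻¹ := by
    rw [← NNReal.coe_lt_coe]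
    change n * (2 * δ) < ((N.nnnorm⁻¹ : NNReal) : ℝ)
    rw [NNReal.coe_inv]
    have h4 : δ * (4 * (n + 1)) = (N.nnnorm : ℝ)⁻¹ := by
      rw [hδ]; field_simp
    nlinarith
  have happ : ApproximatesLinearOn T' T Set.univ c := by
    intro p _ q _
    rw [← map_sub]
    change ‖sumMul y (p - q) - sumMul (fun i : S => (i : A)) (p - q)‖ ≤ _
    refine sumMul_sub_bound _ _ δ ?_ _
    intro i
    rw [norm_sub_rev]
    exact hyd i
  have hnh := happ.image_mem_nhds N (x := 0) Filter.univ_mem (Or.inr hc)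
  have htop : T'.range = ⊤ := by
    apply Submodule.eq_top_of_nonempty_interior'
    refine ⟨T' 0, mem_interior_iff_mem_nhds.2 ?_⟩
    refine Filter.mem_of_superset hnh ?_
    rintro _ ⟨p, -, rfl⟩
    exact ⟨p, rfl⟩
  have hKJ : K ≤ J := by
    intro k hk
    have : (⟨k, hk⟩ : K) ∈ T'.range := htop ▸ Submodule.mem_top
    obtain ⟨p, hp⟩ := this
    have hp' : sumMul y p = k := congrArg Subtype.val hp
    rw [← hp']
    exact sumMul_mem hJ hyJ p
  have : J = K := le_antisymm hJK hKJ
  rw [this]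
  exact hKc

lemma isLeftIdeal_closure {J : Submodule ℂ A} (hJ : IsLeftIdeal J) :
    IsLeftIdeal J.topologicalClosure := by
  intro a x hx
  exact map_mem_closure (continuous_const_mul a) hx fun y hy => hJ a y hy

lemma isClosed_of_ge [CompleteSpace A] {I J : Submodule ℂ A} (hI : IsMaxNonFG I)
    (hJ : IsLeftIdeal J) (hIJ : I ≤ J) : IsClosed (J : Set A) := by
  by_cases h : IsFGLeftIdeal J.topologicalClosure
  · exact isClosed_of_fg_closure hJ h
  · have h1 := hI.2.2 _ (isLeftIdeal_closure hJ) h (hIJ.trans J.le_topologicalClosure)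
    have h2 : J = J.topologicalClosure :=
      le_antisymm J.le_topologicalClosure (h1.le.trans hIJ)
    rw [h2]
    exact J.isClosed_topologicalClosure

lemma isLeftIdeal_sup {J K : Submodule ℂ A} (hJ : IsLeftIdeal J) (hK : IsLeftIdeal K) :
    IsLeftIdeal (J ⊔ K) := by
  intro a x hx
  obtain ⟨y, hy, z, hz, rfl⟩ := Submodule.mem_sup.1 hx
  rw [mul_add]
  exact Submodule.add_mem_sup (hJ _ _ hy) (hK _ _ hz)

lemma isLeftIdeal_range_sharpMul (x : A) :
    IsLeftIdeal (LinearMap.range (sharpMul x : A × ℂ →ₗ[ℂ] A)) := by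
  rintro a _ ⟨p, rfl⟩
  refine ⟨(a * p.1 + p.2 • a, 0), ?_⟩
  simp [sharpMul_apply, mul_add, add_mul, mul_assoc, smul_mul_assoc, mul_smul_comm]

/-- The preimage of a left ideal under right multiplication by `b`. -/
def rightColon (J : Submodule ℂ A) (b : A) : Submodule ℂ A :=
  J.comap ((ContinuousLinearMap.mul ℂ A).flip b : A →ₗ[ℂ] A)

lemma mem_rightColon {J : Submodule ℂ A} {b c : A} : c ∈ rightColon J b ↔ c * b ∈ J := by
  simp [rightColon]

lemma isLeftIdeal_rightColon {J : Submodule ℂ A} (hJ : IsLeftIdeal J) (b : A) :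
    IsLeftIdeal (rightColon J b) := by
  intro a x hx
  rw [mem_rightColon] at hx ⊢
  rw [mul_assoc]
  exact hJ _ _ hx

lemma fg_of_gt {I J : Submodule ℂ A} (hI : IsMaxNonFG I) (hJ : IsLeftIdeal J) (h : I ≤ J)
    {a : A} (ha : a ∈ J) (haI : a ∉ I) : IsFGLeftIdeal J := by
  by_contra hn
  exact haI (hI.2.2 J hJ hn h ▸ ha)

/-- A two-sided ideal in `𝔐∞(A)` is completely prime. -/
lemma mem_or_mem {I : Submodule ℂ A} (hIr : ∀ x ∈ I, ∀ a : A, x * a ∈ I)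
    (hI : IsMaxNonFG I) {a b : A} (hab : a * b ∈ I) : a ∈ I ∨ b ∈ I := by
  classical
  by_contra hcon
  push Not at hcon
  obtain ⟨ha, hb⟩ := hcon
  have hIl := hI.1
  obtain ⟨S, hSsub, hS⟩ : IsFGLeftIdeal (rightColon I b) :=
    fg_of_gt hI (isLeftIdeal_rightColon hIl b)
      (fun x hx => mem_rightColon.2 (hIr x hx b)) (mem_rightColon.2 hab) ha
  let B := LinearMap.range (sharpMul b : A × ℂ →ₗ[ℂ] A)
  have hB : IsLeftIdeal B := isLeftIdeal_range_sharpMul b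
  have hbB : b ∈ B := ⟨(0, 1), by simp [sharpMul_apply]⟩
  obtain ⟨U, hUsub, hU⟩ : IsFGLeftIdeal (I ⊔ B) :=
    fg_of_gt hI (isLeftIdeal_sup hIl hB) le_sup_left (Submodule.mem_sup_right hbB) hb
  have hdec : ∀ s : U, ∃ i ∈ I, ∃ c ∈ B, i + c = s := fun s => Submodule.mem_sup.1 (hUsub s.2)
  choose f hfI g hgB hfg using hdec
  -- the extra generator
  obtain ⟨w, hwI, hw⟩ : ∃ w ∈ I, ∀ (c : A) (l : ℂ), c * b + l • b ∈ I →
      ∃ d ∈ rightColon I b, ∃ m : ℂ, c * b + l • b = d * b + m • w := by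
    by_cases hex : ∃ a' : A, a' * b + b ∈ I
    · obtain ⟨a', ha'⟩ := hex
      refine ⟨_, ha', fun c l hc => ⟨c - l • a', ?_, l, ?_⟩⟩
      · rw [mem_rightColon]
        have := I.sub_mem hc (I.smul_mem l ha')
        convert this using 1
        rw [sub_mul, smul_mul_assoc, smul_add]; abel
      · rw [sub_mul, smul_mul_assoc, smul_add]; abel
    · refine ⟨0, I.zero_mem, fun c l hc => ?_⟩
      have hl : l = 0 := by
        by_contra hl
        apply hex
        refine ⟨l⁻¹ • c, ?_⟩
        have := I.smul_mem l⁻¹ hc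
        rwa [smul_add, smul_smul, inv_mul_cancel₀ hl, one_smul, ← smul_mul_assoc] at this
      subst hl
      refine ⟨c, ?_, 0, by simp⟩
      rw [mem_rightColon]
      simpa using hc
  let G : Finset A := insert w (Finset.univ.image f ∪ S.image (fun s => s * b))
  have hGI : (G : Set A) ⊆ I := by
    intro x hx
    simp only [G, Finset.coe_insert, Finset.coe_union, Finset.coe_image, Set.mem_insert_iff,
      Set.mem_union, Set.mem_image] at hx
    rcases hx with rfl | ⟨s, -, rfl⟩ | ⟨s, hs, rfl⟩
    · exact hwI
    · exact hfI s
    · exact mem_rightColon.1 (hSsub hs)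
  have hGl := isLeftIdeal_leftIdealGen (G : Set A)
  have hGsub := subset_leftIdealGen (G : Set A)
  have hwG : w ∈ leftIdealGen (G : Set A) := hGsub (by simp [G])
  have hfG : ∀ s, f s ∈ leftIdealGen (G : Set A) := fun s => hGsub (by simp [G])
  have hSG : ∀ s ∈ S, s * b ∈ leftIdealGen (G : Set A) := fun s hs => hGsub (by
    simp only [G, Finset.coe_insert, Finset.coe_union, Finset.coe_image, Set.mem_insert_iff,
      Set.mem_union, Set.mem_image]
    exact Or.inr (Or.inr ⟨s, hs, rfl⟩))
  have hcolon : rightColon I b ≤ rightColon (leftIdealGen (G : Set A)) b := by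
    rw [← hS]
    exact leftIdealGen_le (isLeftIdeal_rightColon hGl b) fun s hs => mem_rightColon.2 (hSG s hs)
  have hLB : I ⊔ B ≤ leftIdealGen (G : Set A) ⊔ B := by
    rw [← hU]
    refine leftIdealGen_le (isLeftIdeal_sup hGl hB) fun s hs => ?_
    have := hfg ⟨s, hs⟩
    change s ∈ _
    rw [← show f ⟨s, hs⟩ + g ⟨s, hs⟩ = s from this]
    exact Submodule.add_mem_sup (hfG _) (hgB _)
  apply hI.2.1
  refine ⟨G, hGI, le_antisymm (leftIdealGen_le hIl hGI) fun i hi => ?_⟩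
  obtain ⟨x, hx, _, ⟨p, rfl⟩, hxi⟩ := Submodule.mem_sup.1 (hLB (Submodule.mem_sup_left hi))
  have hxI : x ∈ I := leftIdealGen_le hIl hGI hx
  simp only [ContinuousLinearMap.coe_coe, sharpMul_apply] at hxi
  have hp : p.1 * b + p.2 • b ∈ I := by
    have := I.sub_mem hi hxI
    rwa [← hxi, add_sub_cancel_left] at this
  obtain ⟨d, hd, m, hdm⟩ := hw _ _ hp
  rw [← hxi, hdm]
  exact add_mem hx (add_mem (mem_rightColon.1 (hcolon hd)) (Submodule.smul_mem _ _ hwG))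

lemma exists_eigen_mod [CompleteSpace A] {I : Submodule ℂ A}
    (hIr : ∀ x ∈ I, ∀ a : A, x * a ∈ I)
    (hI : IsMaxNonFG I) (htop : I ≠ ⊤) (b : A) :
    ∃ z : ℂ, ∃ x : A, x ∉ I ∧ x * b - z • x ∈ I := by
  haveI hcl : IsClosed (I : Set A) := isClosed_of_ge hI hI.1 le_rfl
  haveI : Nontrivial (A ⧸ I) := Submodule.Quotient.nontrivial_iff.2 htop
  let T0 : (A ⧸ I) →ₗ[ℂ] (A ⧸ I) :=
    I.mapQ I ((ContinuousLinearMap.mul ℂ A).flip b : A →ₗ[ℂ] A) (fun x hx => by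
      simpa using hIr x hx b)
  have hT0 : ∀ x : A, T0 (Submodule.Quotient.mk x) = Submodule.Quotient.mk (x * b) := by
    intro x
    simp [T0]
  have hq : Topology.IsQuotientMap (Submodule.Quotient.mk : A → A ⧸ I) :=
    isQuotientMap_quotient_mk'
  have hcont : Continuous T0 := by
    rw [hq.continuous_iff]
    have : (T0 ∘ (Submodule.Quotient.mk : A → A ⧸ I)) =
        fun x => Submodule.Quotient.mk (x * b) := funext hT0
    rw [this]
    exact hq.continuous.comp (continuous_mul_const b)
  let T : (A ⧸ I) →L[ℂ] (A ⧸ I) := ⟨T0, hcont⟩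
  obtain ⟨z, x, hx, hxz⟩ := exists_eigen_of_closed_range T (by
    intro z
    rw [← hq.isClosed_preimage]
    let M : A →ₗ[ℂ] A := z • LinearMap.id - ((ContinuousLinearMap.mul ℂ A).flip b : A →ₗ[ℂ] A)
    have hM : ∀ x, M x = z • x - x * b := fun x => by simp [M]
    have hMl : IsLeftIdeal (LinearMap.range M) := by
      rintro a _ ⟨x, rfl⟩
      refine ⟨a * x, ?_⟩
      rw [hM, hM, mul_sub, mul_smul_comm, mul_assoc]
    have hset : (Submodule.Quotient.mk : A → A ⧸ I) ⁻¹'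
        (Set.range fun x : A ⧸ I => z • x - T x) = ((I ⊔ LinearMap.range M : Submodule ℂ A) : Set A) := by
      ext y
      simp only [Set.mem_preimage, Set.mem_range, SetLike.mem_coe]
      constructor
      · rintro ⟨q, hq'⟩
        obtain ⟨x, rfl⟩ := Submodule.Quotient.mk_surjective I q
        have h1 : T (Submodule.Quotient.mk x) = Submodule.Quotient.mk (x * b) := hT0 x
        rw [h1, ← Submodule.Quotient.mk_smul, ← Submodule.Quotient.mk_sub, eq_comm,
          Submodule.Quotient.eq] at hq'
        rw [Submodule.mem_sup]
        exact ⟨_, hq', M x, ⟨x, rfl⟩, by rw [hM]; abel⟩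
      · intro hy
        obtain ⟨i, hi, _, ⟨x, rfl⟩, rfl⟩ := Submodule.mem_sup.1 hy
        refine ⟨Submodule.Quotient.mk x, ?_⟩
        have h1 : T (Submodule.Quotient.mk x) = Submodule.Quotient.mk (x * b) := hT0 x
        rw [h1, ← Submodule.Quotient.mk_smul, ← Submodule.Quotient.mk_sub, eq_comm,
          Submodule.Quotient.eq, hM, add_sub_cancel_right]
        exact hi
    rw [hset]
    exact isClosed_of_ge hI (isLeftIdeal_sup hI.1 hMl) le_sup_left)
  obtain ⟨x, rfl⟩ := Submodule.Quotient.mk_surjective I x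
  refine ⟨z, x, ?_, ?_⟩
  · rwa [ne_eq, Submodule.Quotient.mk_eq_zero] at hx
  · have h1 : T (Submodule.Quotient.mk x) = Submodule.Quotient.mk (x * b) := hT0 x
    rwa [h1, ← Submodule.Quotient.mk_smul, Submodule.Quotient.eq] at hxz

/-- Every element outside `I` is a nonzero multiple of an identity modulo `I`. -/
lemma exists_unit_mod [CompleteSpace A] {I : Submodule ℂ A}
    (hIr : ∀ x ∈ I, ∀ a : A, x * a ∈ I)
    (hI : IsMaxNonFG I) (htop : I ≠ ⊤) {b : A} (hb : b ∉ I) :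
    ∃ z : ℂ, z ≠ 0 ∧ ∃ e : A, b = z • e ∧ ∀ a : A, a * e - a ∈ I ∧ e * a - a ∈ I := by
  obtain ⟨z, x, hx, hxz⟩ := exists_eigen_mod hIr hI htop b
  have hz : z ≠ 0 := by
    rintro rfl
    rw [zero_smul, sub_zero] at hxz
    exact (mem_or_mem hIr hI hxz).elim hx hb
  have hbe : b = z • (z⁻¹ • b) := by rw [smul_smul, mul_inv_cancel₀ hz, one_smul]
  refine ⟨z, hz, z⁻¹ • b, hbe, ?_⟩
  set e := z⁻¹ • b with he
  have hxe : x * e - x ∈ I := by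
    have := I.smul_mem z⁻¹ hxz
    rwa [smul_sub, smul_smul, inv_mul_cancel₀ hz, one_smul, ← mul_smul_comm] at this
  have hl : ∀ y, e * y - y ∈ I := by
    intro y
    have h1 : x * (e * y - y) ∈ I := by
      have := hIr _ hxe y
      rwa [sub_mul, mul_assoc, ← mul_sub] at this
    exact (mem_or_mem hIr hI h1).resolve_left hx
  intro a
  refine ⟨?_, hl a⟩
  have h1 : (a * e - a) * b ∈ I := by
    have := hI.1 a _ (hl b)
    rwa [mul_sub, ← mul_assoc, ← sub_mul] at this
  exact (mem_or_mem hIr hI h1).resolve_right hb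

end alg

end helpers

/-- Theorem 3.1. Let `A` be a Banach algebra and `I` a two-sided
ideal that is maximal among the non-finitely-generated left ideals of `A`. Then either
`I = A`, or `I` is a maximal modular two-sided ideal of codimension `1` in `A`. -/
theorem maxNonFG_twoSided_ideal {A : Type*} [NonUnitalNormedRing A] [NormedSpace ℂ A]
    [IsScalarTower ℂ A A] [SMulCommClass ℂ A A] [CompleteSpace A]
    (I : Submodule ℂ A) (hIr : ∀ x ∈ I, ∀ a : A, x * a ∈ I)
    (hI : IsMaxNonFG I) :
    I = ⊤ ∨
      (Module.finrank ℂ (A ⧸ I) = 1 ∧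
        (∃ u : A, ∀ a : A, a * u - a ∈ I ∧ u * a - a ∈ I) ∧
        I ≠ ⊤ ∧
        ∀ J : Submodule ℂ A, IsLeftIdeal J → (∀ x ∈ J, ∀ a : A, x * a ∈ J) →
          I < J → J = ⊤) := by
  by_cases htop : I = ⊤
  · exact Or.inl htop
  right
  obtain ⟨b₀, hb₀⟩ : ∃ b, b ∉ I := by
    by_contra h
    push Not at h
    exact htop (eq_top_iff.2 fun x _ => h x)
  obtain ⟨z₀, hz₀, u, hbu, hu⟩ := exists_unit_mod hIr hI htop hb₀
  have huI : u ∉ I := fun h => hb₀ (hbu ▸ I.smul_mem z₀ h)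
  have hall : ∀ b : A, ∃ z : ℂ, b - z • u ∈ I ∧ (b ∉ I → z ≠ 0) := by
    intro b
    by_cases hb : b ∈ I
    · exact ⟨0, by simpa using hb, fun h => absurd hb h⟩
    · obtain ⟨z, hz, e, hbe, he⟩ := exists_unit_mod hIr hI htop hb
      refine ⟨z, ?_, fun _ => hz⟩
      have h1 := I.sub_mem (he u).2 (hu e).1
      have h2 : e - u ∈ I := by
        convert h1 using 1
        abel
      rw [hbe, ← smul_sub]
      exact I.smul_mem z h2
  refine ⟨?_, ⟨u, hu⟩, htop, ?_⟩
  · refine finrank_eq_one (Submodule.Quotient.mk u) ?_ ?_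
    · rwa [ne_eq, Submodule.Quotient.mk_eq_zero]
    · intro q
      obtain ⟨b, rfl⟩ := Submodule.Quotient.mk_surjective I q
      obtain ⟨z, hz, -⟩ := hall b
      refine ⟨z, ?_⟩
      rw [← Submodule.Quotient.mk_smul, eq_comm, Submodule.Quotient.eq]
      exact hz
  · intro J hJl hJr hIJ
    obtain ⟨b, hbJ, hbI⟩ := Set.exists_of_ssubset hIJ
    obtain ⟨z, hz, hz0⟩ := hall b
    have hz0 := hz0 hbI
    have h1 : z • u ∈ J := by
      have := J.sub_mem hbJ (hIJ.le hz)
      rwa [sub_sub_cancel] at this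
    have huJ : u ∈ J := by
      have := J.smul_mem z⁻¹ h1
      rwa [smul_smul, inv_mul_cancel₀ hz0, one_smul] at this
    rw [eq_top_iff]
    intro a _
    obtain ⟨w, hw, -⟩ := hall a
    have := J.add_mem (hIJ.le hw) (J.smul_mem w huJ)
    rwa [sub_add_cancel] at this
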